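/- arXiv:2108.01579 — 5 statements merged into one kernel-verified Lean document; each statement's English description precedes it below -/
import Mathlib

section
/- Let A ∈ ℝ^{n×n}, B ∈ ℝ^{n×m}, and let R := R(A,B) ∈ ℝ^{n×nm} be the controllability matrix. Assume: (i) R has no zero rows; (ii) letting J := {j ∈ [1,nm] : the j-th column R e_j is unisigned}, the union over j ∈ J of the nonzero patterns ZP(R e_j) has cardinality at least n−1. Then the pair (A,B) is herdable, i.e., there exists u ∈ ℝ^{nm} with every entry of R u strictly positive. -/
open Matrix

/-- A nonzero real vector is unisigned if all its nonzero entries have the same sign. -/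
def Unisigned {ι : Type*} (v : ι → ℝ) : Prop :=
  v ≠ 0 ∧ ((∀ i, 0 ≤ v i) ∨ (∀ i, v i ≤ 0))

/-- The controllability matrix `[B | AB | A²B | ... | A^{n-1}B]` of the pair `(A, B)`,
with columns indexed by `Fin n × Fin m`. -/
def ctrbMat {n m : ℕ} (A : Matrix (Fin n) (Fin n) ℝ) (B : Matrix (Fin n) (Fin m) ℝ) :
    Matrix (Fin n) (Fin n × Fin m) ℝ :=
  Matrix.of fun i p => (A ^ (p.1 : ℕ) * B) i p.2

/-- If `R w ≥ 0` and `R v` is positive wherever `R w` vanishes, then the image of `R` contains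
a positive vector, namely `R (v + c w)` for `c` large. -/
theorem exists_mulVec_pos_of_nonneg {ι κ : Type*} [Fintype ι] [Fintype κ]
    (R : Matrix ι κ ℝ) (w v : κ → ℝ) (hw : ∀ i, 0 ≤ R.mulVec w i)
    (hv : ∀ i, R.mulVec w i = 0 → 0 < R.mulVec v i) :
    ∃ u : κ → ℝ, ∀ i, 0 < R.mulVec u i := by
  set c : ℝ := ∑ i, |R.mulVec v i| / R.mulVec w i + 1 with hc
  refine ⟨v + c • w, fun i => ?_⟩
  rw [Matrix.mulVec_add, Matrix.mulVec_smul, Pi.add_apply, Pi.smul_apply, smul_eq_mul]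
  rcases (hw i).eq_or_lt with h | h
  · rw [← h, mul_zero, add_zero]
    exact hv i h.symm
  · have hle : |R.mulVec v i| / R.mulVec w i < c := by
      have := Finset.single_le_sum (f := fun i => |R.mulVec v i| / R.mulVec w i)
        (fun j _ => div_nonneg (abs_nonneg _) (hw j)) (Finset.mem_univ i)
      linarith
    rw [div_lt_iff₀ h] at hle
    linarith [neg_abs_le (R.mulVec v i)]

/-- Some combination of the unisigned columns of `R` is nonnegative, and positive on the union of
their nonzero patterns. -/
theorem exists_mulVec_nonneg_pos_of_unisigned {ι κ : Type*} [Fintype κ] (R : Matrix ι κ ℝ) :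
    ∃ w : κ → ℝ, (∀ i, 0 ≤ R.mulVec w i) ∧
      ∀ i, (∃ p, Unisigned (fun i' => R i' p) ∧ R i p ≠ 0) → 0 < R.mulVec w i := by
  have key : ∀ p, ∃ s : ℝ, (∀ i, 0 ≤ R i p * s) ∧
      (Unisigned (fun i' => R i' p) → ∀ i, R i p ≠ 0 → 0 < R i p * s) := by
    intro p
    by_cases hp : Unisigned (fun i' => R i' p)
    · rcases hp.2 with h | h
      · exact ⟨1, fun i => by simpa using h i, fun _ i hi => by
          simpa using lt_of_le_of_ne (h i) hi.symm⟩
      · exact ⟨-1, fun i => by simpa using h i, fun _ i hi => by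
          simpa using lt_of_le_of_ne (h i) hi⟩
    · exact ⟨0, by simp, fun h => absurd h hp⟩
  choose w hw hpos using key
  refine ⟨w, fun i => Finset.sum_nonneg fun p _ => hw p i, ?_⟩
  rintro i ⟨p, hp, hi⟩
  exact Finset.sum_pos' (fun q _ => hw q i) ⟨p, Finset.mem_univ p, hpos p hp i hi⟩

theorem stmt0 {n m : ℕ} (A : Matrix (Fin n) (Fin n) ℝ) (B : Matrix (Fin n) (Fin m) ℝ)
    (R : Matrix (Fin n) (Fin n × Fin m) ℝ) (hR : R = ctrbMat A B)
    -- (i) `R` has no zero rows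
    (hrows : ∀ i : Fin n, ∃ p, R i p ≠ 0)
    -- (ii) the union over unisigned columns of their nonzero patterns has cardinality ≥ n-1
    (hcard : n - 1 ≤
      Set.ncard {i : Fin n | ∃ p, Unisigned (fun i' => R i' p) ∧ R i p ≠ 0}) :
    -- the pair (A,B) is herdable
    ∃ u : Fin n × Fin m → ℝ, ∀ i, 0 < R.mulVec u i := by
  obtain ⟨w, hw, hpos⟩ := exists_mulVec_nonneg_pos_of_unisigned R
  set S : Set (Fin n) := {i | ∃ p, Unisigned (fun i' => R i' p) ∧ R i p ≠ 0}
  have hzero : ∀ i, R.mulVec w i = 0 → i ∈ Sᶜ := fun i hi hS => (hpos i hS).ne' hi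
  have hcompl : Sᶜ.ncard ≤ 1 := by
    have := Set.ncard_add_ncard_compl S
    rw [Nat.card_fin] at this
    omega
  by_cases hk : ∃ k, R.mulVec w k = 0
  · obtain ⟨k, hk⟩ := hk
    obtain ⟨p, hp⟩ := hrows k
    refine exists_mulVec_pos_of_nonneg R w (Pi.single p (R k p)) hw fun i hi => ?_
    obtain rfl : i = k := (Set.ncard_le_one_iff (Set.toFinite _)).mp hcompl (hzero i hi) (hzero k hk)
    simpa using hp
  · exact exists_mulVec_pos_of_nonneg R w 0 hw fun i hi => absurd ⟨i, hi⟩ hk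
end

section
/- Let Φ ∈ ℝ^{n×k} and suppose there exist permutation matrices P₁ ∈ ℝ^{n×n} and P₂ ∈ ℝ^{k×k} such that P₁ Φ P₂ = [[Φ₁₁, Φ₁₂],[0, Φ₂₂]] is block upper triangular, where both Im(Φ₁₁) and Im(Φ₂₂) contain a strictly positive vector. Then there exists u ∈ ℝ^{k} such that every entry of Φ u is strictly positive. -/
open Matrix

open Filter in
/-- If the diagonal blocks of a block upper triangular matrix have strictly positive vectors in
their images, then so does the whole matrix. -/
theorem exists_forall_pos_fromBlocks_mulVec {m₁ m₂ l₁ l₂ : Type*} [Finite m₁]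
    [Fintype l₁] [Fintype l₂]
    (A : Matrix m₁ l₁ ℝ) (B : Matrix m₁ l₂ ℝ) (D : Matrix m₂ l₂ ℝ)
    (hA : ∃ u, ∀ i, 0 < (A *ᵥ u) i) (hD : ∃ u, ∀ i, 0 < (D *ᵥ u) i) :
    ∃ u, ∀ i, 0 < (fromBlocks A B 0 D *ᵥ u) i := by
  obtain ⟨u, hu⟩ := hA
  obtain ⟨v, hv⟩ := hD
  have h : ∀ᶠ t : ℝ in atTop, ∀ i, 0 < t * (A *ᵥ u) i + (B *ᵥ v) i :=
    eventually_all.2 fun i =>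
      (tendsto_atTop_add_const_right _ _
        (tendsto_id.atTop_mul_const (hu i))).eventually_gt_atTop 0
  obtain ⟨t, ht⟩ := h.exists
  refine ⟨Sum.elim (t • u) v, ?_⟩
  rw [fromBlocks_mulVec]
  rintro (i | i)
  · simpa [mulVec_smul] using ht i
  · simpa using hv i

theorem stmt1 {n₁ n₂ k₁ k₂ : ℕ} (Φ : Matrix (Fin (n₁ + n₂)) (Fin (k₁ + k₂)) ℝ)
    (σ₁ : Equiv.Perm (Fin (n₁ + n₂))) (σ₂ : Equiv.Perm (Fin (k₁ + k₂)))
    (Φ₁₁ : Matrix (Fin n₁) (Fin k₁) ℝ) (Φ₁₂ : Matrix (Fin n₁) (Fin k₂) ℝ)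
    (Φ₂₂ : Matrix (Fin n₂) (Fin k₂) ℝ)
    -- P₁ Φ P₂ is block upper triangular with blocks Φ₁₁, Φ₁₂, 0, Φ₂₂
    (hblocks : σ₁.permMatrix ℝ * Φ * σ₂.permMatrix ℝ =
      Matrix.reindex finSumFinEquiv finSumFinEquiv (Matrix.fromBlocks Φ₁₁ Φ₁₂ 0 Φ₂₂))
    -- Im(Φ₁₁) contains a strictly positive vector
    (h11 : ∃ u : Fin k₁ → ℝ, ∀ i, 0 < Φ₁₁.mulVec u i)
    -- Im(Φ₂₂) contains a strictly positive vector
    (h22 : ∃ u : Fin k₂ → ℝ, ∀ i, 0 < Φ₂₂.mulVec u i) :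
    ∃ u : Fin (k₁ + k₂) → ℝ, ∀ i, 0 < Φ.mulVec u i := by
  obtain ⟨v, hv⟩ := exists_forall_pos_fromBlocks_mulVec Φ₁₁ Φ₁₂ Φ₂₂ h11 h22
  refine ⟨σ₂.permMatrix ℝ *ᵥ (v ∘ finSumFinEquiv.symm), fun i => ?_⟩
  have h := congrFun (congrArg (· *ᵥ (v ∘ finSumFinEquiv.symm)) hblocks) (σ₁.symm i)
  simp only [← mulVec_mulVec, reindex_apply, submatrix_mulVec_equiv] at h
  rw [permMatrix_mulVec σ₁] at h
  simp only [Function.comp_apply, Equiv.apply_symm_apply, Equiv.symm_symm, Function.comp_assoc,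
    Equiv.symm_comp_self, Function.comp_id] at h
  rw [h]
  exact hv _
end

section
/- Let A ∈ ℝ^{n×n}, B ∈ ℝ^{n×m}, and let R := R(A,B) ∈ ℝ^{n×nm} be the controllability matrix; assume R has no zero rows. Define J := {j ∈ [1,nm] : R e_j is unisigned} and H := ⋃_{j∈J} ZP(R e_j). Suppose that for every h ∈ [1,n]∖H there exists j ∈ [1,nm]∖J such that (i) [R]_{hj} ≠ 0, and (ii) for every k ∈ [1,n]∖H, [R]_{kj} ≠ 0 implies sign([R]_{kj}) = sign([R]_{hj}). Then the pair (A,B) is herdable. -/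
open Matrix

/-- Vectors in the range of a matrix that are nonnegative on `S` and positive at a single index of
`T ⊆ S` can be summed to one that is nonnegative on `S` and positive on all of `T`. -/
theorem exists_mulVec_nonneg_pos {ι κ : Type*} [Fintype ι] [Fintype κ] (R : Matrix ι κ ℝ)
    {S T : Set ι} (hTS : T ⊆ S)
    (h : ∀ i ∈ T, ∃ u, 0 < (R *ᵥ u) i ∧ ∀ k ∈ S, 0 ≤ (R *ᵥ u) k) :
    ∃ u, (∀ k ∈ S, 0 ≤ (R *ᵥ u) k) ∧ ∀ i ∈ T, 0 < (R *ᵥ u) i := by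
  have h' : ∀ i, ∃ u, (i ∈ T → 0 < (R *ᵥ u) i) ∧ ∀ k ∈ S, 0 ≤ (R *ᵥ u) k := by
    intro i
    by_cases hi : i ∈ T
    · obtain ⟨u, hu, hu'⟩ := h i hi
      exact ⟨u, fun _ => hu, hu'⟩
    · exact ⟨0, fun hi' => absurd hi' hi, by simp⟩
  choose u hpos hnonneg using h'
  have hsum : ∀ k, (R *ᵥ ∑ i, u i) k = ∑ i, (R *ᵥ u i) k := by
    intro k
    rw [Matrix.mulVec_sum, Finset.sum_apply]
  refine ⟨∑ i, u i, fun k hk => ?_, fun i hi => ?_⟩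
  · rw [hsum]
    exact Finset.sum_nonneg fun i _ => hnonneg i k hk
  · rw [hsum]
    exact Finset.sum_pos' (fun j _ => hnonneg j i (hTS hi)) ⟨i, Finset.mem_univ i, hpos i hi⟩

/-- A column whose entries on `S` have the sign of its nonzero entry at `i`, rescaled by that
sign, is nonnegative on `S` and positive at `i`. -/
theorem exists_mulVec_pos_of_column {ι κ : Type*} [Fintype κ] [DecidableEq κ]
    (R : Matrix ι κ ℝ) {S : Set ι} {i : ι} {p : κ} (hi : R i p ≠ 0)
    (h : ∀ k ∈ S, 0 ≤ R k p * R i p) :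
    ∃ u, 0 < (R *ᵥ u) i ∧ ∀ k ∈ S, 0 ≤ (R *ᵥ u) k := by
  refine ⟨Pi.single p (R i p), ?_, fun k hk => ?_⟩
  · simpa [Matrix.mulVec_single] using mul_self_pos.mpr hi
  · simpa [Matrix.mulVec_single] using h k hk

theorem mul_nonneg_of_sign_eq {x y : ℝ} (h : x ≠ 0 → Real.sign x = Real.sign y) :
    0 ≤ x * y := by
  by_cases hx : x = 0
  · simp [hx]
  · have hy := Real.sign_mul_nonneg y
    rw [← h hx] at hy
    rcases lt_or_gt_of_ne hx with hx | hx
    · rw [Real.sign_of_neg hx] at hy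
      exact mul_nonneg_of_nonpos_of_nonpos hx.le (by linarith)
    · rw [Real.sign_of_pos hx] at hy
      exact mul_nonneg hx.le (by linarith)

/-- A sufficiently large multiple of a nonnegative vector dominates a given vector on the support
of the former. -/
theorem exists_nonneg_mul_add_pos {ι : Type*} [Fintype ι] {a : ι → ℝ} (b : ι → ℝ)
    (ha : ∀ i, 0 ≤ a i) : ∃ c : ℝ, 0 ≤ c ∧ ∀ i, 0 < a i → 0 < c * a i + b i := by
  have hnonneg : ∀ i, 0 ≤ |b i| / a i := fun i => div_nonneg (abs_nonneg _) (ha i)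
  refine ⟨∑ i, |b i| / a i + 1, ?_, fun i hi => ?_⟩
  · exact add_nonneg (Finset.sum_nonneg fun i _ => hnonneg i) zero_le_one
  have hle : |b i| / a i ≤ ∑ j, |b j| / a j :=
    Finset.single_le_sum (fun j _ => hnonneg j) (Finset.mem_univ i)
  have hlt : |b i| < (∑ j, |b j| / a j + 1) * a i := (div_lt_iff₀ hi).mp (by linarith)
  linarith [neg_abs_le (b i)]

theorem stmt2 {n m : ℕ} (A : Matrix (Fin n) (Fin n) ℝ) (B : Matrix (Fin n) (Fin m) ℝ)
    (R : Matrix (Fin n) (Fin n × Fin m) ℝ) (hR : R = ctrbMat A B)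
    -- `R` has no zero rows
    (hrows : ∀ i : Fin n, ∃ p, R i p ≠ 0)
    -- J : set of indices of unisigned columns of R
    (J : Set (Fin n × Fin m)) (hJ : J = {p | Unisigned (fun i => R i p)})
    -- H : union of the nonzero patterns of the unisigned columns
    (H : Set (Fin n)) (hH : H = {h | ∃ p ∈ J, R h p ≠ 0})
    -- for every h ∉ H there is a column j ∉ J whose h-th entry is nonzero and all of whose
    -- nonzero entries at indices outside H have the same sign as its h-th entry
    (hcond : ∀ h : Fin n, h ∉ H → ∃ p, p ∉ J ∧ R h p ≠ 0 ∧
      ∀ k : Fin n, k ∉ H → R k p ≠ 0 → Real.sign (R k p) = Real.sign (R h p)) :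
    -- the pair (A,B) is herdable
    ∃ u : Fin n × Fin m → ℝ, ∀ i, 0 < R.mulVec u i := by
  obtain ⟨v, hv, hvH⟩ := exists_mulVec_nonneg_pos R (Set.subset_univ H) fun i hi => by
    subst hH hJ
    obtain ⟨p, hp, hne⟩ := hi
    refine exists_mulVec_pos_of_column R hne fun k _ => ?_
    rcases hp.2 with hp | hp
    · exact mul_nonneg (hp k) (hp i)
    · exact mul_nonneg_of_nonpos_of_nonpos (hp k) (hp i)
  obtain ⟨w, -, hw⟩ := exists_mulVec_nonneg_pos R (subset_refl Hᶜ) fun i hi => by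
    obtain ⟨p, -, hne, hp⟩ := hcond i hi
    exact exists_mulVec_pos_of_column R hne fun k hk => mul_nonneg_of_sign_eq (hp k hk)
  obtain ⟨c, hc, hpos⟩ := exists_nonneg_mul_add_pos (R *ᵥ w) fun i => hv i (Set.mem_univ i)
  refine ⟨c • v + w, fun i => ?_⟩
  rw [Matrix.mulVec_add, Matrix.mulVec_smul, Pi.add_apply, Pi.smul_apply, smul_eq_mul]
  by_cases hi : i ∈ H
  · exact hpos i (hvH i hi)
  · exact add_pos_of_nonneg_of_pos (mul_nonneg hc (hv i (Set.mem_univ i))) (hw i hi)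
end

section
/- Let A ∈ ℝ^{n×n} be block-partitioned as A = [[A₁₁, A₁₂],[A₂₁, A₂₂]] with A₁₁ ∈ ℝ^{m×m}, and let B = [I_m; 0] ∈ ℝ^{n×m}. Then for every integer k ≥ 1 there exist matrices X₀, X₁, …, X_{k−1} ∈ ℝ^{m×m} with X_{k−1} = I_m such that [0 | I_{n−m}] A^k B = Σ_{j=0}^{k−1} A₂₂^j A₂₁ X_j. -/
open Matrix

/-- The lower left block of a power of a block matrix, expanded in powers of the lower right
block. -/
theorem toBlocks₂₁_fromBlocks_pow {R m p : Type*} [Semiring R] [Fintype m] [Fintype p]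
    [DecidableEq m] [DecidableEq p]
    (A : Matrix m m R) (B : Matrix m p R) (C : Matrix p m R) (D : Matrix p p R) (k : ℕ) :
    (fromBlocks A B C D ^ k).toBlocks₂₁ =
      ∑ j ∈ Finset.range k, D ^ j * C * (fromBlocks A B C D ^ (k - 1 - j)).toBlocks₁₁ := by
  induction k with
  | zero =>
    ext i j
    simp [toBlocks₂₁]
  | succ k ih =>
    have hstep : (fromBlocks A B C D ^ (k + 1)).toBlocks₂₁ =
        C * (fromBlocks A B C D ^ k).toBlocks₁₁ + D * (fromBlocks A B C D ^ k).toBlocks₂₁ := by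
      rw [pow_succ']
      conv_lhs => rw [← fromBlocks_toBlocks (fromBlocks A B C D ^ k)]
      rw [fromBlocks_multiply, toBlocks_fromBlocks₂₁]
    rw [hstep, ih, Finset.sum_range_succ', add_comm, Matrix.mul_sum]
    congr 1
    · refine Finset.sum_congr rfl fun j _ => ?_
      rw [show k + 1 - 1 - (j + 1) = k - 1 - j by omega, pow_succ']
      simp only [Matrix.mul_assoc]
    · simp

theorem stmt7 {m p : ℕ}
    (A₁₁ : Matrix (Fin m) (Fin m) ℝ) (A₁₂ : Matrix (Fin m) (Fin p) ℝ)
    (A₂₁ : Matrix (Fin p) (Fin m) ℝ) (A₂₂ : Matrix (Fin p) (Fin p) ℝ)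
    (A : Matrix (Fin m ⊕ Fin p) (Fin m ⊕ Fin p) ℝ)
    (hA : A = Matrix.fromBlocks A₁₁ A₁₂ A₂₁ A₂₂)
    (B : Matrix (Fin m ⊕ Fin p) (Fin m) ℝ)
    -- B = [I_m ; 0]
    (hB : B = Matrix.of fun i j => if i = Sum.inl j then 1 else 0)
    (k : ℕ) (hk : 1 ≤ k) :
    -- [0 | I_{n-m}] A^k B = Σ_{j=0}^{k-1} A₂₂^j A₂₁ X_j with X_{k-1} = I_m
    ∃ X : ℕ → Matrix (Fin m) (Fin m) ℝ, X (k - 1) = 1 ∧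
      (Matrix.of fun (i : Fin p) (j : Fin m) => (A ^ k * B) (Sum.inr i) j) =
        ∑ j ∈ Finset.range k, A₂₂ ^ j * A₂₁ * X j := by
  subst hA hB
  refine ⟨fun j => (fromBlocks A₁₁ A₁₂ A₂₁ A₂₂ ^ (k - 1 - j)).toBlocks₁₁, ?_, ?_⟩
  · ext i j
    simp [toBlocks₁₁, one_apply]
  · rw [← toBlocks₂₁_fromBlocks_pow]
    ext i j
    simp [mul_apply, toBlocks₂₁]
end

section
/- Let A₂₃ ∈ ℝ^{m₁×m₂}, A₃₂ ∈ ℝ^{m₂×m₁}, and Γ ∈ ℝ^{m₁}. Consider the matrix M = [[0, A₂₃],[A₃₂, 0]] ∈ ℝ^{(m₁+m₂)×(m₁+m₂)} and the vector b = [Γ; 0] ∈ ℝ^{m₁+m₂}. Then the image of the controllability matrix R(M, b) contains a strictly positive vector if and only if both of the following hold: (a) the pair (A₂₃A₃₂, Γ) is herdable, i.e., the image of R₁ := [Γ | (A₂₃A₃₂)Γ | ... | (A₂₃A₃₂)^{m₁−1}Γ] contains a strictly positive vector; and (b) the image of the matrix A₃₂ · R₁ contains a strictly positive vector. -/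
open Matrix

open Polynomial in
/-- By Cayley–Hamilton, the image of a controllability matrix consists of all `q(N) v`. -/
theorem exists_mulVec_krylov_iff_exists_aeval {n : Type*} [Fintype n] [DecidableEq n] {p : ℕ}
    (hp : Fintype.card n = p) (N : Matrix n n ℝ) (v w : n → ℝ) :
    (∃ u, (Matrix.of fun i (k : Fin p) => ((N ^ (k : ℕ)) *ᵥ v) i) *ᵥ u = w) ↔
      ∃ q : ℝ[X], aeval N q *ᵥ v = w := by
  constructor
  · rintro ⟨u, rfl⟩
    refine ⟨∑ k : Fin p, C (u k) * X ^ (k : ℕ), ?_⟩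
    ext i
    simp only [map_sum, map_mul, map_pow, aeval_C, aeval_X, Algebra.algebraMap_eq_smul_one,
      smul_mul_assoc, one_mul, Matrix.sum_mulVec, Finset.sum_apply, Matrix.smul_mulVec,
      Pi.smul_apply, smul_eq_mul]
    simp [Matrix.mulVec, dotProduct, mul_comm]
  · rintro ⟨q, rfl⟩
    have hmod : aeval N (q %ₘ N.charpoly) = aeval N q :=
      Polynomial.aeval_modByMonic_eq_self_of_root (Matrix.aeval_self_charpoly N)
    refine ⟨fun k => (q %ₘ N.charpoly).coeff k, ?_⟩
    have hsum : aeval N (q %ₘ N.charpoly)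
        = ∑ k : Fin p, (q %ₘ N.charpoly).coeff k • N ^ (k : ℕ) := by
      rw [Fin.sum_univ_eq_sum_range (fun k => (q %ₘ N.charpoly).coeff k • N ^ k)]
      by_cases h0 : q %ₘ N.charpoly = 0
      · simp [h0]
      refine aeval_eq_sum_range' ?_ N
      rw [natDegree_lt_iff_degree_lt h0, ← hp, ← Matrix.charpoly_degree_eq_dim N]
      exact degree_modByMonic_lt _ (Matrix.charpoly_monic N)
    rw [← hmod, hsum]
    ext i
    simp only [Matrix.sum_mulVec, Finset.sum_apply, Matrix.smul_mulVec, Pi.smul_apply,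
      smul_eq_mul]
    simp [Matrix.mulVec, dotProduct, mul_comm]

section AntiDiagonal

variable {m n : Type*} [Fintype m] [Fintype n] [DecidableEq m] [DecidableEq n]
  (B : Matrix m n ℝ) (C : Matrix n m ℝ) (v : m → ℝ)

open Polynomial in
theorem exists_aeval_fromBlocks_antidiagonal_mulVec (q : ℝ[X]) :
    ∃ q₁ q₂ : ℝ[X], aeval (fromBlocks 0 B C 0) q *ᵥ Sum.elim v 0 =
      Sum.elim (aeval (B * C) q₁ *ᵥ v) (C *ᵥ (aeval (B * C) q₂ *ᵥ v)) := by
  induction q using Polynomial.induction_on' with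
  | add p q hp hq =>
    obtain ⟨p₁, p₂, hp⟩ := hp
    obtain ⟨q₁, q₂, hq⟩ := hq
    refine ⟨p₁ + q₁, p₂ + q₂, ?_⟩
    rw [map_add, add_mulVec, hp, hq, map_add, map_add, add_mulVec, add_mulVec, mulVec_add]
    ext (i | i) <;> simp
  | monomial k a =>
    induction k with
    | zero =>
      refine ⟨Polynomial.C a, 0, ?_⟩
      ext (i | i) <;> simp [Algebra.algebraMap_eq_smul_one, smul_mulVec]
    | succ k ih =>
      obtain ⟨q₁, q₂, h⟩ := ih
      refine ⟨X * q₂, q₁, ?_⟩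
      rw [← X_mul_monomial, map_mul, ← mulVec_mulVec, h, aeval_X, fromBlocks_mulVec, map_mul,
        aeval_X]
      ext (i | i) <;> simp [← mulVec_mulVec]

open Polynomial in
theorem aeval_fromBlocks_antidiagonal_expand_mulVec (q : ℝ[X]) :
    aeval (fromBlocks 0 B C 0) (expand ℝ 2 q) *ᵥ Sum.elim v 0 =
      Sum.elim (aeval (B * C) q *ᵥ v) 0 := by
  rw [expand_aeval, pow_two, fromBlocks_multiply]
  induction q using Polynomial.induction_on' with
  | add p q hp hq =>
    rw [map_add, add_mulVec, hp, hq, map_add, add_mulVec]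
    ext (i | i) <;> simp
  | monomial k a =>
    induction k with
    | zero => ext (i | i) <;> simp [Algebra.algebraMap_eq_smul_one, smul_mulVec]
    | succ k ih =>
      rw [← X_mul_monomial, map_mul, ← mulVec_mulVec, ih, aeval_X, fromBlocks_mulVec, map_mul,
        aeval_X]
      ext (i | i) <;> simp [← mulVec_mulVec]

open Polynomial in
theorem exists_aeval_fromBlocks_antidiagonal_mulVec_eq (q₁ q₂ : ℝ[X]) :
    ∃ q : ℝ[X], aeval (fromBlocks 0 B C 0) q *ᵥ Sum.elim v 0 =
      Sum.elim (aeval (B * C) q₁ *ᵥ v) (C *ᵥ (aeval (B * C) q₂ *ᵥ v)) := by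
  refine ⟨expand ℝ 2 q₁ + X * expand ℝ 2 q₂, ?_⟩
  rw [map_add, add_mulVec, map_mul, ← mulVec_mulVec,
    aeval_fromBlocks_antidiagonal_expand_mulVec, aeval_fromBlocks_antidiagonal_expand_mulVec,
    aeval_X, fromBlocks_mulVec]
  ext (i | i) <;> simp

end AntiDiagonal


theorem stmt15 {m₁ m₂ : ℕ}
    (A₂₃ : Matrix (Fin m₁) (Fin m₂) ℝ) (A₃₂ : Matrix (Fin m₂) (Fin m₁) ℝ)
    (Γ : Fin m₁ → ℝ)
    -- M = [[0, A₂₃],[A₃₂, 0]]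
    (M : Matrix (Fin m₁ ⊕ Fin m₂) (Fin m₁ ⊕ Fin m₂) ℝ)
    (hM : M = Matrix.fromBlocks 0 A₂₃ A₃₂ 0)
    -- b = [Γ ; 0]
    (b : Fin m₁ ⊕ Fin m₂ → ℝ) (hb : b = Sum.elim Γ 0)
    -- R(M, b) = [b | Mb | ... | M^{m₁+m₂-1}b]
    (R : Matrix (Fin m₁ ⊕ Fin m₂) (Fin (m₁ + m₂)) ℝ)
    (hR : R = Matrix.of fun i (k : Fin (m₁ + m₂)) => (M ^ (k : ℕ)).mulVec b i)
    -- R₁ = [Γ | (A₂₃A₃₂)Γ | ... | (A₂₃A₃₂)^{m₁-1}Γ]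
    (R₁ : Matrix (Fin m₁) (Fin m₁) ℝ)
    (hR₁ : R₁ = Matrix.of fun i (k : Fin m₁) => ((A₂₃ * A₃₂) ^ (k : ℕ)).mulVec Γ i) :
    -- Im(R(M,b)) contains a strictly positive vector iff (a) and (b) hold
    ((∃ u, ∀ i, 0 < R.mulVec u i) ↔
      ((∃ u, ∀ i, 0 < R₁.mulVec u i) ∧
       (∃ u, ∀ i, 0 < (A₃₂ * R₁).mulVec u i))) := by
  subst hM hb hR hR₁
  have hcard : Fintype.card (Fin m₁ ⊕ Fin m₂) = m₁ + m₂ := by simp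
  have key := fun w => exists_mulVec_krylov_iff_exists_aeval hcard
    (fromBlocks 0 A₂₃ A₃₂ 0) (Sum.elim Γ 0) w
  have key₁ := fun w => exists_mulVec_krylov_iff_exists_aeval (Fintype.card_fin m₁)
    (A₂₃ * A₃₂) Γ w
  simp only [← mulVec_mulVec]
  constructor
  · rintro ⟨u, hu⟩
    obtain ⟨q, hq⟩ := (key _).1 ⟨u, rfl⟩
    obtain ⟨q₁, q₂, h⟩ := exists_aeval_fromBlocks_antidiagonal_mulVec A₂₃ A₃₂ Γ q
    obtain ⟨u₁, hu₁⟩ := (key₁ _).2 ⟨q₁, rfl⟩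
    obtain ⟨u₂, hu₂⟩ := (key₁ _).2 ⟨q₂, rfl⟩
    rw [← hq, h] at hu
    exact ⟨⟨u₁, fun i => hu₁ ▸ hu (Sum.inl i)⟩, ⟨u₂, fun i => hu₂ ▸ hu (Sum.inr i)⟩⟩
  · rintro ⟨⟨u₁, hu₁⟩, ⟨u₂, hu₂⟩⟩
    obtain ⟨q₁, hq₁⟩ := (key₁ _).1 ⟨u₁, rfl⟩
    obtain ⟨q₂, hq₂⟩ := (key₁ _).1 ⟨u₂, rfl⟩
    obtain ⟨q, hq⟩ := exists_aeval_fromBlocks_antidiagonal_mulVec_eq A₂₃ A₃₂ Γ q₁ q₂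
    obtain ⟨u, hu⟩ := (key _).2 ⟨q, rfl⟩
    refine ⟨u, ?_⟩
    rw [hu, hq, hq₁, hq₂]
    rintro (i | i)
    exacts [hu₁ i, hu₂ i]
end
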